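/- Computational claim for Graph I.1 (from the proof of Theorem D). Among the 9-tuples (a₁₂, a₁₃, a₂₁, a₂₃, a₃₁, a₃₂, v₁, v₂, v₃) with every coordinate in the subset {1, 2} of ZMod 3, those satisfying the constraint a₁₂·a₂₃·a₃₁ = a₁₃·a₃₂·a₂₁ (δ-invariant δ ≡ 0 mod 3) number exactly 256; among these 256 tuples, exactly 64 yield a matrix M₃ of rank 1 and exactly 192 yield a matrix M₃ of rank 2 over ZMod 3. -/

import Mathlib

open Matrix

noncomputable section

/-- The 3×3 system matrix (formula (3)) of a cyclic cubic field whose conductor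
has `t = 3` prime divisors. -/
def M3 (a12 a13 a21 a23 a31 a32 v1 v2 v3 : ZMod 3) :
    Matrix (Fin 3) (Fin 3) (ZMod 3) :=
  !![-a12 * v2 - a13 * v3, a21 * v1, a31 * v1;
     a12 * v2, -a21 * v1 - a23 * v3, a32 * v2;
     a13 * v3, a23 * v3, -a31 * v1 - a32 * v2]

/-- Embedding of the nine-bit cube onto the tuples with coordinates in `{1, 2}`. -/
def bitVal (b : Bool) : ZMod 3 := if b then 1 else 2

abbrev Bits := Bool × Bool × Bool × Bool × Bool × Bool × Bool × Bool × Bool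

def tup : Bits → (Fin 9 → ZMod 3)
  | (a, b, c, d, e, f, g, h, i) =>
    ![bitVal a, bitVal b, bitVal c, bitVal d, bitVal e, bitVal f, bitVal g, bitVal h, bitVal i]

lemma bitVal_inj : Function.Injective bitVal := by decide

lemma bitVal_mem (b : Bool) : bitVal b ∈ ({1, 2} : Set (ZMod 3)) := by
  cases b <;> simp [bitVal]

lemma exists_bitVal {x : ZMod 3} (h : x ∈ ({1, 2} : Set (ZMod 3))) : ∃ b, bitVal b = x := by
  rcases h with h | h
  · exact ⟨true, h.symm⟩
  · exact ⟨false, (Set.mem_singleton_iff.mp h).symm⟩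

lemma tup_inj : Function.Injective tup := by
  rintro ⟨a, b, c, d, e, f, g, h, i⟩ ⟨a2, b2, c2, d2, e2, f2, g2, h2, i2⟩ H
  have Hk := fun k => congrFun H k
  have q0 := bitVal_inj (Hk 0)
  have q1 := bitVal_inj (Hk 1)
  have q2 := bitVal_inj (Hk 2)
  have q3 := bitVal_inj (Hk 3)
  have q4 := bitVal_inj (Hk 4)
  have q5 := bitVal_inj (Hk 5)
  have q6 := bitVal_inj (Hk 6)
  have q7 := bitVal_inj (Hk 7)
  have q8 := bitVal_inj (Hk 8)
  simp only [q0, q1, q2, q3, q4, q5, q6, q7, q8]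

lemma tup_mem (b : Bits) (i : Fin 9) : tup b i ∈ ({1, 2} : Set (ZMod 3)) := by
  obtain ⟨a, b, c, d, e, f, g, h, k⟩ := b
  fin_cases i <;> exact bitVal_mem _

lemma exists_tup {t : Fin 9 → ZMod 3} (h : ∀ i, t i ∈ ({1, 2} : Set (ZMod 3))) :
    ∃ b, tup b = t := by
  choose b hb using fun i => exists_bitVal (h i)
  refine ⟨(b 0, b 1, b 2, b 3, b 4, b 5, b 6, b 7, b 8), ?_⟩
  funext i
  fin_cases i <;> exact hb _

/-- Counting tuples reduces to counting in the nine-bit cube. -/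
lemma ncard_tuples (P : (Fin 9 → ZMod 3) → Prop) (Q : Bits → Bool)
    (hPQ : ∀ b, P (tup b) ↔ Q b = true) :
    {t : Fin 9 → ZMod 3 | (∀ i, t i ∈ ({1, 2} : Set (ZMod 3))) ∧ P t}.ncard =
      (Finset.univ.filter fun b => Q b = true).card := by
  have : {t : Fin 9 → ZMod 3 | (∀ i, t i ∈ ({1, 2} : Set (ZMod 3))) ∧ P t} =
      Set.image tup ((Finset.univ.filter fun b => Q b = true : Finset Bits) : Set Bits) := by
    ext t
    constructor
    · rintro ⟨h, hP⟩
      obtain ⟨b, rfl⟩ := exists_tup h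
      exact ⟨b, by simpa using (hPQ b).1 hP, rfl⟩
    · rintro ⟨b, hb, rfl⟩
      exact ⟨tup_mem b, (hPQ b).2 (by simpa using hb)⟩
  rw [this, Set.ncard_image_of_injective _ tup_inj, Set.ncard_coe_finset]

def MM (t : Fin 9 → ZMod 3) : Matrix (Fin 3) (Fin 3) (ZMod 3) :=
  M3 (t 0) (t 1) (t 2) (t 3) (t 4) (t 5) (t 6) (t 7) (t 8)

/-- The rank-one criterion: all minors through the pivot entry `(0, 1)` vanish. -/
def Flat (M : Matrix (Fin 3) (Fin 3) (ZMod 3)) : Prop :=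
  ∀ i j, M 0 1 * M i j - M 0 j * M i 1 = 0

instance (M : Matrix (Fin 3) (Fin 3) (ZMod 3)) : Decidable (Flat M) := by
  unfold Flat; infer_instance

lemma rank_le_one_of_flat {M : Matrix (Fin 3) (Fin 3) (ZMod 3)} (h0 : M 0 1 ≠ 0)
    (h : Flat M) : M.rank ≤ 1 := by
  have : M = vecMulVec (fun i => M i 1) (fun j => (M 0 1)⁻¹ * M 0 j) := by
    ext i j
    have := h i j
    simp only [vecMulVec_apply]
    field_simp
    linear_combination this
  rw [this]
  exact rank_vecMulVec_le _ _

lemma flat_of_rank_le_one {M : Matrix (Fin 3) (Fin 3) (ZMod 3)} (h : M.rank ≤ 1) : Flat M := by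
  intro i j
  by_contra hne
  have hu : IsUnit (M.submatrix ![0, i] ![1, j]) := by
    rw [Matrix.isUnit_iff_isUnit_det, isUnit_iff_ne_zero, det_fin_two]
    simpa using hne
  have h2 := rank_of_isUnit _ hu
  have h3 := rank_submatrix_le M ![0, i] ![1, j]
  rw [Fintype.card_fin] at h2
  omega

lemma M3_det (a12 a13 a21 a23 a31 a32 v1 v2 v3 : ZMod 3) :
    (M3 a12 a13 a21 a23 a31 a32 v1 v2 v3).det = 0 := by
  rw [det_fin_three]
  simp [M3]
  ring

lemma MM_rank_le (t : Fin 9 → ZMod 3) : (MM t).rank ≤ 2 := by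
  by_contra h
  have h3 : (MM t).rank = 3 := le_antisymm (by simpa using (MM t).rank_le_width) (by omega)
  have hu : LinearIndependent (ZMod 3) (MM t).row := by
    rw [linearIndependent_iff_card_eq_finrank_span, Set.finrank, ← rank_eq_finrank_span_row, h3]
    simp
  rw [linearIndependent_rows_iff_isUnit, isUnit_iff_isUnit_det] at hu
  simp [MM, M3_det] at hu

lemma pivot_ne (b : Bits) : MM (tup b) 0 1 ≠ 0 := by
  have key : ∀ x y : Bool, bitVal x * bitVal y ≠ 0 := by decide
  obtain ⟨a, b, c, d, e, f, g, h, k⟩ := b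
  exact key c g

lemma rank_pos_of (b : Bits) : 1 ≤ (MM (tup b)).rank := by
  have hu : IsUnit ((MM (tup b)).submatrix ![(0 : Fin 3)] ![(1 : Fin 3)]) := by
    rw [Matrix.isUnit_iff_isUnit_det, isUnit_iff_ne_zero, det_fin_one]
    exact pivot_ne b
  have h2 := rank_of_isUnit _ hu
  have h3 := rank_submatrix_le (MM (tup b)) ![(0 : Fin 3)] ![(1 : Fin 3)]
  rw [Fintype.card_fin] at h2
  omega

lemma rank_one_iff (b : Bits) : (MM (tup b)).rank = 1 ↔ Flat (MM (tup b)) :=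
  ⟨fun h => flat_of_rank_le_one h.le,
    fun h => le_antisymm (rank_le_one_of_flat (pivot_ne b) h) (rank_pos_of b)⟩

lemma rank_two_iff (b : Bits) : (MM (tup b)).rank = 2 ↔ ¬ Flat (MM (tup b)) := by
  rw [← rank_one_iff]
  have := MM_rank_le (tup b)
  have := rank_pos_of b
  omega

def delta (t : Fin 9 → ZMod 3) : ZMod 3 := t 0 * t 3 * t 4 - t 1 * t 5 * t 2

/-- **Computational claim for Graph I.1 (from the proof of Theorem D).**
Among the 9-tuples `(a₁₂, a₁₃, a₂₁, a₂₃, a₃₁, a₃₂, v₁, v₂, v₃)` with every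
coordinate in `{1, 2} ⊆ ZMod 3` and satisfying `δ = a₁₂a₂₃a₃₁ − a₁₃a₃₂a₂₁ ≡ 0`,
there are exactly 256 tuples; exactly 64 of them give a matrix `M3` of rank 1
and exactly 192 give a matrix `M3` of rank 2. -/
theorem M3_count_graphI1 :
    {t : Fin 9 → ZMod 3 | (∀ i, t i ∈ ({1, 2} : Set (ZMod 3))) ∧
      t 0 * t 3 * t 4 - t 1 * t 5 * t 2 = 0}.ncard = 256 ∧
    {t : Fin 9 → ZMod 3 | (∀ i, t i ∈ ({1, 2} : Set (ZMod 3))) ∧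
      t 0 * t 3 * t 4 - t 1 * t 5 * t 2 = 0 ∧
      (M3 (t 0) (t 1) (t 2) (t 3) (t 4) (t 5) (t 6) (t 7) (t 8)).rank = 1}.ncard = 64 ∧
    {t : Fin 9 → ZMod 3 | (∀ i, t i ∈ ({1, 2} : Set (ZMod 3))) ∧
      t 0 * t 3 * t 4 - t 1 * t 5 * t 2 = 0 ∧
      (M3 (t 0) (t 1) (t 2) (t 3) (t 4) (t 5) (t 6) (t 7) (t 8)).rank = 2}.ncard = 192 := by
  refine ⟨?_, ?_, ?_⟩
  · rw [ncard_tuples _ (fun b => decide (delta (tup b) = 0)) (fun b => by rw [decide_eq_true_iff]; rfl)]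
    decide +kernel
  · rw [ncard_tuples _ (fun b => decide (delta (tup b) = 0 ∧ Flat (MM (tup b))))
      (fun b => by rw [decide_eq_true_iff, ← rank_one_iff]; rfl)]
    decide +kernel
  · rw [ncard_tuples _ (fun b => decide (delta (tup b) = 0 ∧ ¬ Flat (MM (tup b))))
      (fun b => by rw [decide_eq_true_iff, ← rank_two_iff]; rfl)]
    decide +kernel
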